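/- arXiv:2104.10045 — 7 statements merged into one kernel-verified Lean document; each statement's English description precedes it below -/
import Mathlib

section
/- Let G : (0, π) → ℝ be defined by G(r) = cos r · log(2·tan(r/2)) + 1 − cos r. Then G is twice differentiable on (0, π) and satisfies the ordinary differential equation G''(r) + (cos r / sin r)·G'(r) + 2·G(r) = 0 for every r ∈ (0, π). -/
/-- On `(0, π)` the function `log (2 * tan (t / 2))` is a primitive of `1 / sin`. -/
theorem hasDerivAt_log_two_mul_tan_half {r : ℝ} (hr : r ∈ Set.Ioo (0 : ℝ) Real.pi) :
    HasDerivAt (fun t : ℝ => Real.log (2 * Real.tan (t / 2))) (Real.sin r)⁻¹ r := by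
  obtain ⟨h0, hpi⟩ := hr
  have hs : Real.sin (r / 2) ≠ 0 :=
    (Real.sin_pos_of_pos_of_lt_pi (by linarith) (by linarith)).ne'
  have hc : Real.cos (r / 2) ≠ 0 :=
    (Real.cos_pos_of_mem_Ioo ⟨by linarith, by linarith⟩).ne'
  have htan : Real.tan (r / 2) ≠ 0 := by
    rw [Real.tan_eq_sin_div_cos]
    exact div_ne_zero hs hc
  have hsin : Real.sin r = 2 * Real.sin (r / 2) * Real.cos (r / 2) := by
    rw [← Real.sin_two_mul, mul_div_cancel₀ r two_ne_zero]
  have hhalf : HasDerivAt (fun t : ℝ => t / 2) (1 / 2) r := (hasDerivAt_id r).div_const 2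
  have htan' : HasDerivAt (fun t : ℝ => Real.tan (t / 2))
      (1 / Real.cos (r / 2) ^ 2 * (1 / 2)) r :=
    HasDerivAt.comp (h₂ := Real.tan) r (Real.hasDerivAt_tan hc) hhalf
  refine ((htan'.const_mul 2).log (mul_ne_zero two_ne_zero htan)).congr_deriv ?_
  rw [hsin, Real.tan_eq_sin_div_cos]
  field_simp

/-- The Green's function profile `G(r) = cos r · log(2·tan(r/2)) + 1 − cos r` is twice
differentiable on `(0, π)` and satisfies the ODE
`G'' + (cos r / sin r)·G' + 2·G = 0` there (the radial form of `(Δ + 2)(G ∘ d_p) = 0`). -/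
theorem green_profile_ode :
    ∃ G' G'' : ℝ → ℝ, ∀ r ∈ Set.Ioo (0 : ℝ) Real.pi,
      HasDerivAt
        (fun t : ℝ => Real.cos t * Real.log (2 * Real.tan (t / 2)) + 1 - Real.cos t)
        (G' r) r ∧
      HasDerivAt G' (G'' r) r ∧
      G'' r + (Real.cos r / Real.sin r) * G' r +
        2 * (Real.cos r * Real.log (2 * Real.tan (r / 2)) + 1 - Real.cos r) = 0 := by
  refine ⟨fun t => -(Real.sin t * Real.log (2 * Real.tan (t / 2))) +
      Real.cos t / Real.sin t + Real.sin t,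
    fun t => -(Real.cos t * Real.log (2 * Real.tan (t / 2))) - 1 - 1 / Real.sin t ^ 2 +
      Real.cos t, fun r hr => ?_⟩
  have hlog := hasDerivAt_log_two_mul_tan_half hr
  have hs : Real.sin r ≠ 0 := (Real.sin_pos_of_mem_Ioo hr).ne'
  have hsin := Real.hasDerivAt_sin r
  have hcos := Real.hasDerivAt_cos r
  refine ⟨?_, ?_, ?_⟩
  · refine (((hcos.mul hlog).add_const 1).sub hcos).congr_deriv ?_
    ring
  · refine (((hsin.mul hlog).neg.add (hcos.div hsin hs)).add hsin).congr_deriv ?_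
    field_simp
    linear_combination -Real.sin_sq_add_cos_sq r
  · field_simp
    linear_combination Real.sin_sq_add_cos_sq r
end

section
/- Let G : (0, π) → ℝ be defined by G(r) = cos r · log(2·tan(r/2)) + 1 − cos r. There exists a constant C > 0 such that for all r ∈ (0, 1/2), |G(r) − log r| ≤ C·r²·|log r|. (Equivalently, G(r) = (1 + O(r²))·log r as r → 0⁺.) -/
/-- The ratio `2·tan(r/2) / r` is at least `1`, and its logarithm is `O(r²)`. -/
theorem log_two_mul_tan_half_sub_log {r : ℝ} (h0 : 0 < r) (h1 : r < 1 / 2) :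
    0 ≤ Real.log (2 * Real.tan (r / 2)) - Real.log r ∧
      Real.log (2 * Real.tan (r / 2)) - Real.log r ≤ r ^ 2 := by
  have hpi := Real.pi_gt_three
  have htan : r / 2 < Real.tan (r / 2) := Real.lt_tan (by linarith) (by linarith)
  have hcos : 1 - (r / 2) ^ 2 / 2 ≤ Real.cos (r / 2) := Real.one_sub_sq_div_two_le_cos
  have hcos_pos : 0 < Real.cos (r / 2) := by nlinarith
  have hsin : Real.sin (r / 2) ≤ r / 2 := Real.sin_le (by linarith)
  have hupper : 2 * Real.tan (r / 2) / r ≤ 1 + r ^ 2 := by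
    rw [div_le_iff₀ h0, Real.tan_eq_sin_div_cos, ← mul_div_assoc, div_le_iff₀ hcos_pos]
    have hsq : r ^ 2 ≤ 1 := by nlinarith
    have hprod : 1 ≤ (1 + r ^ 2) * Real.cos (r / 2) := by
      nlinarith [mul_le_mul_of_nonneg_left hcos (by positivity : 0 ≤ 1 + r ^ 2),
        mul_nonneg (sq_nonneg r) (sub_nonneg.2 hsq)]
    nlinarith [mul_le_mul_of_nonneg_left hprod h0.le]
  refine ⟨sub_nonneg.2 (Real.log_le_log h0 (by linarith)), ?_⟩
  rw [← Real.log_div (by linarith) h0.ne']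
  have hlog := Real.log_le_sub_one_of_pos (div_pos (by linarith : 0 < 2 * Real.tan (r / 2)) h0)
  linarith

/-- `G(r) = (1 + O(r²))·log r` as `r → 0⁺`: there is `C > 0` such that for all
`r ∈ (0, 1/2)`, `|G(r) − log r| ≤ C·r²·|log r|`, where
`G(r) = cos r · log(2·tan(r/2)) + 1 − cos r`. -/
theorem green_profile_asymptotics :
    ∃ C : ℝ, 0 < C ∧ ∀ r : ℝ, 0 < r → r < 1 / 2 →
      |(Real.cos r * Real.log (2 * Real.tan (r / 2)) + 1 - Real.cos r) - Real.log r| ≤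
        C * r ^ 2 * |Real.log r| := by
  refine ⟨4, by norm_num, fun r h0 h1 => ?_⟩
  obtain ⟨hq0, hq1⟩ := log_two_mul_tan_half_sub_log h0 h1
  have hcos : 1 - r ^ 2 / 2 ≤ Real.cos r := Real.one_sub_sq_div_two_le_cos
  have hcos_le : Real.cos r ≤ 1 := Real.cos_le_one r
  have hcos_nonneg : 0 ≤ Real.cos r := by nlinarith
  have hlog : Real.log r ≤ -(1 / 2) := by
    have := Real.log_le_sub_one_of_pos h0
    linarith
  rw [abs_of_neg (by linarith : Real.log r < 0)]
  set q := Real.log (2 * Real.tan (r / 2)) - Real.log r with hq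
  have heq : Real.cos r * Real.log (2 * Real.tan (r / 2)) + 1 - Real.cos r - Real.log r
      = (1 - Real.cos r) * -Real.log r + Real.cos r * q + (1 - Real.cos r) := by
    rw [hq]; ring
  have hfirst : (1 - Real.cos r) * -Real.log r ≤ r ^ 2 / 2 * -Real.log r :=
    mul_le_mul_of_nonneg_right (by linarith) (by linarith)
  have hfirst_nonneg : 0 ≤ (1 - Real.cos r) * -Real.log r :=
    mul_nonneg (by linarith) (by linarith)
  have hsecond : Real.cos r * q ≤ r ^ 2 := (mul_le_of_le_one_left hq0 hcos_le).trans hq1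
  have hsecond_nonneg : 0 ≤ Real.cos r * q := mul_nonneg hcos_nonneg hq0
  have hscale : r ^ 2 * (1 / 2) ≤ r ^ 2 * -Real.log r :=
    mul_le_mul_of_nonneg_left (by linarith) (sq_nonneg r)
  rw [heq, abs_of_nonneg (by linarith)]
  linarith
end

section
/- Let G : (0, π) → ℝ be defined by G(r) = cos r · log(2·tan(r/2)) + 1 − cos r, let α = 1/10, and for τ > 0 define h_τ(r) = G(r) − log(2r/τ) − log(τ/2)·cos r on (0, π). There exist constants C > 0 and τ₀ > 0 such that for all τ ∈ (0, τ₀), all r ∈ (τ^α, 9·τ^α), and each k ∈ {0, 1, 2}, the k-th derivative of h_τ satisfies |h_τ^{(k)}(r)| ≤ C·τ^{(2−k)·α}·|log τ|. -/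
open Real in
/-- The derivative of `log (2 tan (x / 2))` on `(0, π)` is `1 / sin x`. -/
theorem hasDerivAt_log_two_mul_tan_half_s8 {x : ℝ} (h0 : 0 < x) (h1 : x < π) :
    HasDerivAt (fun y : ℝ => log (2 * tan (y / 2))) (sin x)⁻¹ x := by
  have hc : 0 < cos (x / 2) := cos_pos_of_mem_Ioo ⟨by linarith, by linarith⟩
  have hs : 0 < sin (x / 2) := sin_pos_of_pos_of_lt_pi (by linarith) (by linarith)
  have hid : HasDerivAt (fun y : ℝ => y / 2) (1 / 2) x := (hasDerivAt_id x).div_const 2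
  have ht := ((hasDerivAt_tan hc.ne').comp x hid).const_mul 2
  have hne : 2 * tan (x / 2) ≠ 0 := by
    rw [tan_eq_sin_div_cos]; positivity
  refine (ht.log hne).congr_deriv ?_
  have hsin : sin x = 2 * sin (x / 2) * cos (x / 2) := by
    rw [← sin_two_mul]; congr 1; ring
  simp only [Function.comp_apply]
  rw [hsin, tan_eq_sin_div_cos]
  field_simp

open Real in
theorem hasDerivAt_green_profile_sub {τ x : ℝ} (hτ : 0 < τ) (h0 : 0 < x) (h1 : x < π) :
    HasDerivAt (fun x : ℝ => (cos x * log (2 * tan (x / 2)) + 1 - cos x) -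
        log (2 * x / τ) - log (τ / 2) * cos x)
      (sin x * (1 + log (τ / 2) - log (2 * tan (x / 2))) + cos x * (sin x)⁻¹ - x⁻¹) x := by
  have hlog : HasDerivAt (fun y : ℝ => log (2 * y / τ)) x⁻¹ x := by
    have h : HasDerivAt (fun y : ℝ => 2 * y / τ) (2 * 1 / τ) x :=
      ((hasDerivAt_id x).const_mul 2).div_const τ
    refine (h.log (by positivity)).congr_deriv ?_
    field_simp
  refine (((((hasDerivAt_cos x).mul (hasDerivAt_log_two_mul_tan_half_s8 h0 h1)).add_const 1).sub
    (hasDerivAt_cos x)).sub hlog |>.sub ((hasDerivAt_cos x).const_mul _)).congr_deriv ?_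
  ring

open Real in
theorem hasDerivAt_deriv_green_profile_sub (L : ℝ) {x : ℝ} (h0 : 0 < x) (h1 : x < π) :
    HasDerivAt (fun x : ℝ =>
        sin x * (1 + L - log (2 * tan (x / 2))) + cos x * (sin x)⁻¹ - x⁻¹)
      (cos x * (1 + L - log (2 * tan (x / 2))) - 1 - ((sin x ^ 2)⁻¹ - (x ^ 2)⁻¹)) x := by
  have hs : sin x ≠ 0 := (sin_pos_of_pos_of_lt_pi h0 h1).ne'
  refine ((((hasDerivAt_sin x).mul
    ((hasDerivAt_log_two_mul_tan_half_s8 h0 h1).const_sub (1 + L))).add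
    ((hasDerivAt_cos x).mul ((hasDerivAt_sin x).inv hs))).sub
    (hasDerivAt_inv h0.ne')).congr_deriv ?_
  simp only [Pi.inv_apply]
  field_simp
  linear_combination (-x ^ 2) * sin_sq_add_cos_sq x

open Real in
theorem abs_cos_mul_inv_sin_sub_inv_le {x : ℝ} (h0 : 0 < x) (h1 : x ≤ 1) :
    |cos x * (sin x)⁻¹ - x⁻¹| ≤ x := by
  have hs1 : x - x ^ 3 / 4 < sin x := by
    linarith [sin_gt_sub_cube h0, pow_pos h0 3]
  have hs2 : sin x < x := sin_lt h0
  have hc1 : 1 - x ^ 2 / 2 ≤ cos x := one_sub_sq_div_two_le_cos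
  have hc2 : cos x ≤ 1 := cos_le_one x
  have hs3 : 3 / 4 * x ≤ sin x := by nlinarith [mul_pos h0 h0]
  have hs : 0 < sin x := by linarith
  have e : cos x * (sin x)⁻¹ - x⁻¹ = (x * cos x - sin x) / (x * sin x) := by
    field_simp
  have hd : 3 / 4 * x ^ 3 ≤ x * (x * sin x) := by nlinarith [mul_pos h0 h0]
  have hx3 : 0 < x ^ 3 := by positivity
  rw [e, abs_div, abs_of_pos (mul_pos h0 hs), div_le_iff₀ (mul_pos h0 hs), abs_le]
  constructor <;> nlinarith

open Real in
theorem abs_inv_sin_sq_sub_inv_sq_le {x : ℝ} (h0 : 0 < x) (h1 : x ≤ 1) :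
    |(sin x ^ 2)⁻¹ - (x ^ 2)⁻¹| ≤ 1 := by
  have hs1 : x - x ^ 3 / 4 < sin x := by
    linarith [sin_gt_sub_cube h0, pow_pos h0 3]
  have hs2 : sin x < x := sin_lt h0
  have hs3 : 3 / 4 * x ≤ sin x := by nlinarith [mul_pos h0 h0]
  have hs : 0 < sin x := by linarith
  have e : (sin x ^ 2)⁻¹ - (x ^ 2)⁻¹ = (x ^ 2 - sin x ^ 2) / (x ^ 2 * sin x ^ 2) := by
    field_simp
  have hsq : 9 / 16 * x ^ 2 ≤ sin x ^ 2 := by nlinarith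
  have hd : 9 / 16 * x ^ 4 ≤ x ^ 2 * sin x ^ 2 := by nlinarith [mul_pos h0 h0]
  have hn : (x - sin x) * (x + sin x) ≤ x ^ 3 / 4 * (2 * x) := by
    apply mul_le_mul <;> first | positivity | linarith
  have hn0 : 0 ≤ (x - sin x) * (x + sin x) := mul_nonneg (by linarith) (by linarith)
  have hx4 : 0 < x ^ 4 := by positivity
  have hp : 0 < x ^ 2 * sin x ^ 2 := by positivity
  rw [e, abs_div, abs_of_pos hp, div_le_iff₀ hp, abs_le]
  constructor <;> nlinarith

open Real in
theorem two_mul_tan_half_bounds {x : ℝ} (h0 : 0 < x) (h1 : x ≤ 1) :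
    x ≤ 2 * tan (x / 2) ∧ 2 * tan (x / 2) ≤ x * (1 + x ^ 2) := by
  have hy : 0 < x / 2 := by linarith
  refine ⟨by linarith [lt_tan hy (by linarith [pi_gt_three])], ?_⟩
  have hs2 : sin (x / 2) < x / 2 := sin_lt hy
  have hc1 : 1 - (x / 2) ^ 2 / 2 ≤ cos (x / 2) := one_sub_sq_div_two_le_cos
  have hx2 : x ^ 2 ≤ 1 := by nlinarith
  have hc : 0 < cos (x / 2) := by nlinarith
  rw [tan_eq_sin_div_cos, ← mul_div_assoc, div_le_iff₀ hc]
  have h2 : 1 ≤ (1 + x ^ 2) * cos (x / 2) := by nlinarith [sq_nonneg x]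
  nlinarith

open Real in
theorem abs_log_two_mul_tan_half_sub_log_le {x : ℝ} (h0 : 0 < x) (h1 : x ≤ 1) :
    |log (2 * tan (x / 2)) - log x| ≤ x ^ 2 := by
  obtain ⟨ha, hb⟩ := two_mul_tan_half_bounds h0 h1
  have hl := log_le_log h0 ha
  have hu := log_le_log (h0.trans_le ha) hb
  rw [log_mul h0.ne' (by positivity)] at hu
  have := log_le_sub_one_of_pos (show 0 < 1 + x ^ 2 by positivity)
  rw [abs_le]
  constructor <;> nlinarith [sq_nonneg x]

open Real Filter Topology in
theorem green_profile_matching_estimate :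
    ∃ C : ℝ, 0 < C ∧ ∃ τ₀ : ℝ, 0 < τ₀ ∧
      ∀ τ : ℝ, 0 < τ → τ < τ₀ →
        ∀ r : ℝ, τ ^ ((1 : ℝ) / 10) < r → r < 9 * τ ^ ((1 : ℝ) / 10) →
          ∀ k : ℕ, k ≤ 2 →
            |iteratedDeriv k
                (fun x : ℝ =>
                  (Real.cos x * Real.log (2 * Real.tan (x / 2)) + 1 - Real.cos x) -
                    Real.log (2 * x / τ) - Real.log (τ / 2) * Real.cos x) r| ≤
              C * τ ^ (((2 : ℝ) - (k : ℝ)) * ((1 : ℝ) / 10)) * |Real.log τ| := by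
  refine ⟨500, by norm_num, (1 / 18) ^ 10, by positivity, ?_⟩
  intro τ hτ hτ0 r hr1 hr2 k hk
  set t : ℝ := τ ^ ((1 : ℝ) / 10) with ht
  have ht0 : 0 < t := by positivity
  have ht10 : t ^ 10 = τ := by
    rw [ht, ← rpow_natCast, ← rpow_mul hτ.le]; norm_num
  have ht1 : t < 1 / 18 := lt_of_pow_lt_pow_left₀ 10 (by norm_num) (ht10 ▸ hτ0)
  have hpow : ∀ n : ℕ, τ ^ ((n : ℝ) * ((1 : ℝ) / 10)) = t ^ n := fun n => by
    rw [ht, ← rpow_natCast, ← rpow_mul hτ.le, mul_comm]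
  have hr0 : 0 < r := ht0.trans hr1
  have hr3 : r ≤ 1 := by linarith
  have hrpi : r < π := by linarith [pi_gt_three]
  have hlogt : log τ = 10 * log t := by rw [← ht10, log_pow]; norm_num
  have hlt : log t ≤ -(17 / 18) := by
    have h := log_le_sub_one_of_pos ht0
    linarith
  set ℓ : ℝ := |log τ| with hℓ
  have hℓeq : ℓ = -log τ := abs_of_nonpos (by linarith)
  have hℓ1 : 1 ≤ ℓ := by linarith
  have hL : |log (τ / 2)| ≤ 2 * ℓ := by
    rw [log_div hτ.ne' two_ne_zero, abs_le]
    have h2 := log_two_lt_d9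
    have h3 := log_two_gt_d9
    constructor <;> linarith
  obtain ⟨ha, hb⟩ := two_mul_tan_half_bounds hr0 hr3
  have hu : |log (2 * tan (r / 2))| ≤ ℓ := by
    have h1 := log_le_log ht0 (hr1.le.trans ha)
    have h2 : log (2 * tan (r / 2)) ≤ 0 :=
      log_nonpos (by linarith) (hb.trans (by nlinarith))
    rw [abs_le]; constructor <;> linarith
  have hcs : |cos r| ≤ 1 := abs_cos_le_one r
  have hsn : |sin r| ≤ r := by
    simpa [abs_of_pos hr0] using abs_sin_le_abs (x := r)
  have hA : |1 + log (τ / 2) - log (2 * tan (r / 2))| ≤ 4 * ℓ := by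
    rw [abs_le] at *; constructor <;> linarith
  have hev : (deriv (fun x : ℝ => (cos x * log (2 * tan (x / 2)) + 1 - cos x) -
        log (2 * x / τ) - log (τ / 2) * cos x)) =ᶠ[𝓝 r]
      (fun x => sin x * (1 + log (τ / 2) - log (2 * tan (x / 2))) + cos x * (sin x)⁻¹ - x⁻¹) := by
    filter_upwards [Ioo_mem_nhds hr0 hrpi] with x hx
    exact (hasDerivAt_green_profile_sub hτ hx.1 hx.2).deriv
  interval_cases k
  · have hc : |1 - cos r| ≤ r ^ 2 := by
      have := one_sub_sq_div_two_le_cos (x := r)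
      rw [abs_le]; constructor <;> nlinarith [cos_le_one r]
    have hlog : log (2 * r / τ) = log r - log (τ / 2) := by
      rw [← log_div hr0.ne' (by positivity)]; congr 1; field_simp
    have e : (cos r * log (2 * tan (r / 2)) + 1 - cos r) - log (2 * r / τ)
        - log (τ / 2) * cos r = (1 - cos r) * (1 + log (τ / 2) - log (2 * tan (r / 2)))
          + (log (2 * tan (r / 2)) - log r) := by rw [hlog]; ring
    have hp := hpow 2
    simp only [iteratedDeriv_zero, Nat.cast_zero, sub_zero]
    push_cast at hp
    rw [hp, e]
    have hm := mul_le_mul hc hA (abs_nonneg _) (by positivity)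
    rw [← abs_mul] at hm
    have hr : r ^ 2 ≤ 81 * t ^ 2 := by nlinarith
    calc _ ≤ r ^ 2 * (4 * ℓ) + r ^ 2 :=
          (abs_add_le _ _).trans (add_le_add hm (abs_log_two_mul_tan_half_sub_log_le hr0 hr3))
      _ ≤ r ^ 2 * (4 * ℓ) + r ^ 2 * ℓ := by nlinarith [sq_nonneg r]
      _ = 5 * r ^ 2 * ℓ := by ring
      _ ≤ 500 * t ^ 2 * ℓ :=
          mul_le_mul_of_nonneg_right (by nlinarith) (by linarith)
  · have hp := hpow 1
    rw [iteratedDeriv_one, (hasDerivAt_green_profile_sub hτ hr0 hrpi).deriv,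
      show ((2 : ℝ) - (1 : ℕ)) = (1 : ℕ) by norm_num, hp, pow_one]
    have hm := mul_le_mul hsn hA (abs_nonneg _) hr0.le
    rw [← abs_mul] at hm
    rw [add_sub_assoc]
    calc _ ≤ r * (4 * ℓ) + r :=
          (abs_add_le _ _).trans (add_le_add hm (abs_cos_mul_inv_sin_sub_inv_le hr0 hr3))
      _ ≤ r * (4 * ℓ) + r * ℓ := by nlinarith
      _ = 5 * r * ℓ := by ring
      _ ≤ 500 * t * ℓ :=
          mul_le_mul_of_nonneg_right (by linarith) (by linarith)
  · have hp := hpow 0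
    rw [iteratedDeriv_succ, iteratedDeriv_one, hev.deriv_eq,
      (hasDerivAt_deriv_green_profile_sub _ hr0 hrpi).deriv,
      show ((2 : ℝ) - (2 : ℕ)) = (0 : ℕ) by norm_num, hp, pow_zero]
    have hm := mul_le_mul hcs hA (abs_nonneg _) zero_le_one
    rw [← abs_mul] at hm
    have hi := abs_inv_sin_sq_sub_inv_sq_le hr0 hr3
    rw [abs_le] at hm hi ⊢
    constructor <;> linarith
end

section
/- The function Φ₂ : (0, π) → ℝ defined by Φ₂(r) = 1 + cos r · log(tan(r/2)) is twice differentiable and satisfies Φ₂''(r) + (cos r / sin r)·Φ₂'(r) + 2·Φ₂(r) = 0 for every r ∈ (0, π). -/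
/-- On `(0, π)`, `log (tan (t / 2))` is a primitive of the cosecant. -/
theorem hasDerivAt_log_tan_half {r : ℝ} (hr : r ∈ Set.Ioo (0 : ℝ) Real.pi) :
    HasDerivAt (fun t : ℝ => Real.log (Real.tan (t / 2))) (1 / Real.sin r) r := by
  have hs : 0 < Real.sin (r / 2) :=
    Real.sin_pos_of_pos_of_lt_pi (by linarith [hr.1]) (by linarith [hr.1, hr.2])
  have hc : 0 < Real.cos (r / 2) :=
    Real.cos_pos_of_mem_Ioo ⟨by linarith [hr.1, Real.pi_pos], by linarith [hr.2]⟩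
  have htan : Real.tan (r / 2) ≠ 0 := by
    rw [Real.tan_eq_sin_div_cos]
    exact (div_pos hs hc).ne'
  have hsin : Real.sin r = 2 * Real.sin (r / 2) * Real.cos (r / 2) := by
    rw [← Real.sin_two_mul, mul_div_cancel₀ r two_ne_zero]
  have h : HasDerivAt (fun t : ℝ => Real.tan (t / 2)) (1 / Real.cos (r / 2) ^ 2 * (1 / 2)) r :=
    HasDerivAt.comp (h₂ := Real.tan) r (Real.hasDerivAt_tan hc.ne') ((hasDerivAt_id r).div_const 2)
  refine (h.log htan).congr_deriv ?_
  rw [hsin, Real.tan_eq_sin_div_cos]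
  field_simp

/-- The radial profile `Φ₂(r) = 1 + cos r · log(tan(r/2))` of the two-point LD solution is
twice differentiable on `(0, π)` and satisfies `Φ₂'' + (cos r / sin r)·Φ₂' + 2·Φ₂ = 0` there. -/
theorem two_point_LD_solution_ode :
    ∃ Φ' Φ'' : ℝ → ℝ, ∀ r ∈ Set.Ioo (0 : ℝ) Real.pi,
      HasDerivAt (fun t : ℝ => 1 + Real.cos t * Real.log (Real.tan (t / 2))) (Φ' r) r ∧
      HasDerivAt Φ' (Φ'' r) r ∧
      Φ'' r + (Real.cos r / Real.sin r) * Φ' r +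
        2 * (1 + Real.cos r * Real.log (Real.tan (r / 2))) = 0 := by
  refine ⟨fun t => -Real.sin t * Real.log (Real.tan (t / 2)) + Real.cos t / Real.sin t,
    fun t => -Real.cos t * Real.log (Real.tan (t / 2)) - 1 - 1 / Real.sin t ^ 2,
    fun r hr => ?_⟩
  have hs : Real.sin r ≠ 0 := (Real.sin_pos_of_mem_Ioo hr).ne'
  have hlog := hasDerivAt_log_tan_half hr
  refine ⟨?_, ?_, ?_⟩
  · refine (((Real.hasDerivAt_cos r).mul hlog).const_add 1).congr_deriv ?_
    ring
  · refine (((Real.hasDerivAt_sin r).neg.mul hlog).add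
      ((Real.hasDerivAt_cos r).div (Real.hasDerivAt_sin r) hs)).congr_deriv ?_
    simp only [Pi.neg_apply]
    field_simp
    linear_combination -Real.sin_sq_add_cos_sq r
  · field_simp
    linear_combination Real.sin_sq_add_cos_sq r
end

section
/- For τ > 0 define φ_cat(r) = τ·log(r/τ + √((r/τ)² − 1)) and φ'(r) = τ/√(r² − τ²), and set α = 1/10. There exist constants C > 0 and τ₀ > 0 such that for all τ ∈ (0, τ₀), ∫_{τ}^{τ^α} cos²(φ_cat(r)) · √(1 + (φ'(r))²/cos²(φ_cat(r))) · sin r dr ≤ (1 − cos(τ^α)) + C·τ² + (5/8)·τ²·|log τ|. -/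
/-- The area density of a graph of height `u` with `c = cos² u` and `p = |∇u|²` is at most the
Euclidean one. -/
lemma mul_sqrt_one_add_div_le {c p : ℝ} (hc : 0 ≤ c) (hc1 : c ≤ 1) (hp : 0 ≤ p) :
    c * √(1 + p / c) ≤ √(1 + p) := by
  rcases hc.eq_or_lt with rfl | hc
  · simp
  · apply Real.le_sqrt_of_sq_le
    rw [mul_pow, Real.sq_sqrt (by positivity)]
    have : c ^ 2 * (1 + p / c) = c ^ 2 + c * p := by field_simp
    rw [this]
    nlinarith

lemma sqrt_one_add_div_sqrt_sq {τ r : ℝ} (hτ : 0 < τ) (hr : τ < r) :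
    √(1 + (τ / √(r ^ 2 - τ ^ 2)) ^ 2) = r / √(r ^ 2 - τ ^ 2) := by
  have h : 0 < r ^ 2 - τ ^ 2 := by nlinarith
  have hr0 : 0 < r := hτ.trans hr
  rw [← Real.sqrt_sq (show 0 ≤ r / √(r ^ 2 - τ ^ 2) by positivity), div_pow, div_pow,
    Real.sq_sqrt h.le]
  congr 1
  field_simp
  ring

/-- A primitive of `sin r + (r ^ 2 / √(r ^ 2 - τ ^ 2) - r)`. -/
noncomputable def catenoidPrimitive (τ r : ℝ) : ℝ :=
  -Real.cos r + (r * √(r ^ 2 - τ ^ 2) + τ ^ 2 * Real.log (r + √(r ^ 2 - τ ^ 2)) - r ^ 2) / 2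

lemma hasDerivAt_catenoidPrimitive {τ r : ℝ} (hτ : 0 < τ) (hr : τ < r) :
    HasDerivAt (catenoidPrimitive τ) (Real.sin r + (r ^ 2 / √(r ^ 2 - τ ^ 2) - r)) r := by
  have h : 0 < r ^ 2 - τ ^ 2 := by nlinarith
  have hr0 : 0 < r := hτ.trans hr
  have hs : 0 < √(r ^ 2 - τ ^ 2) := Real.sqrt_pos.2 h
  have hss : √(r ^ 2 - τ ^ 2) ^ 2 = r ^ 2 - τ ^ 2 := Real.sq_sqrt h.le
  have hd : HasDerivAt (fun x : ℝ => √(x ^ 2 - τ ^ 2)) (r / √(r ^ 2 - τ ^ 2)) r := by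
    convert ((hasDerivAt_pow 2 r).sub_const (τ ^ 2)).sqrt h.ne' using 1
    field_simp
    simp [mul_comm]
  have hlog := ((hasDerivAt_id r).add hd).log (by simp only [Pi.add_apply, id]; positivity)
  refine ((Real.hasDerivAt_cos r).neg.add
    (((((hasDerivAt_id r).mul hd).add (hlog.const_mul (τ ^ 2))).sub
      (hasDerivAt_pow 2 r)).div_const 2)).congr_deriv ?_
  simp only [Pi.add_apply, id]
  generalize √(r ^ 2 - τ ^ 2) = s at *
  have hsum : (1 + r / s) / (r + s) = 1 / s := by
    field_simp
    ring
  rw [hsum]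
  field_simp
  push_cast
  linear_combination hss

lemma continuousOn_catenoidPrimitive {τ R : ℝ} (hτ : 0 < τ) :
    ContinuousOn (catenoidPrimitive τ) (Set.Icc τ R) := by
  have hne : ∀ r ∈ Set.Icc τ R, r + √(r ^ 2 - τ ^ 2) ≠ 0 := fun r hr => by
    have := hτ.trans_le hr.1
    positivity
  unfold catenoidPrimitive
  fun_prop (disch := assumption)

lemma catenoidPrimitive_sub_le {τ R : ℝ} (hτ : 0 < τ) (hR : τ < R) (hR1 : R ≤ 1) :
    catenoidPrimitive τ R - catenoidPrimitive τ τ ≤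
      1 - Real.cos R + τ ^ 2 - τ ^ 2 * Real.log τ / 2 := by
  have hR0 : 0 < R := hτ.trans hR
  have hs : √(R ^ 2 - τ ^ 2) ≤ R := Real.sqrt_le_iff.2 ⟨hR0.le, by nlinarith⟩
  have hlog : Real.log (R + √(R ^ 2 - τ ^ 2)) ≤ 1 :=
    (Real.log_le_sub_one_of_pos (by positivity)).trans (by linarith)
  have hlog' := mul_le_mul_of_nonneg_left hlog (sq_nonneg τ)
  have hcos := Real.cos_le_one τ
  simp only [catenoidPrimitive, sub_self, Real.sqrt_zero, mul_zero, add_zero]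
  nlinarith

open MeasureTheory in
/-- Area estimate for a catenoidal bridge (proof of Lemma 4.3): with `α = 1/10`,
`φ_cat(r) = τ·log(r/τ + √((r/τ)² − 1))` and `φ'(r) = τ/√(r² − τ²)`, there exist `C > 0` and
`τ₀ > 0` such that for all `τ ∈ (0, τ₀)`,
`∫_τ^{τ^α} cos²(φ_cat r)·√(1 + (φ' r)²/cos²(φ_cat r))·sin r dr
  ≤ (1 − cos(τ^α)) + C·τ² + (5/8)·τ²·|log τ|` (the improper integral being finite). -/
theorem catenoid_bridge_area_bound :
    ∃ C : ℝ, 0 < C ∧ ∃ τ₀ : ℝ, 0 < τ₀ ∧ ∀ τ : ℝ, 0 < τ → τ < τ₀ →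
      IntervalIntegrable
        (fun r : ℝ =>
          Real.cos (τ * Real.log (r / τ + Real.sqrt ((r / τ) ^ 2 - 1))) ^ 2 *
            Real.sqrt (1 + (τ / Real.sqrt (r ^ 2 - τ ^ 2)) ^ 2 /
              Real.cos (τ * Real.log (r / τ + Real.sqrt ((r / τ) ^ 2 - 1))) ^ 2) *
            Real.sin r)
        volume τ (τ ^ ((1 : ℝ) / 10)) ∧
      (∫ r in τ..(τ ^ ((1 : ℝ) / 10)),
          Real.cos (τ * Real.log (r / τ + Real.sqrt ((r / τ) ^ 2 - 1))) ^ 2 *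
            Real.sqrt (1 + (τ / Real.sqrt (r ^ 2 - τ ^ 2)) ^ 2 /
              Real.cos (τ * Real.log (r / τ + Real.sqrt ((r / τ) ^ 2 - 1))) ^ 2) *
            Real.sin r) ≤
        (1 - Real.cos (τ ^ ((1 : ℝ) / 10))) + C * τ ^ 2 +
          (5 / 8) * τ ^ 2 * |Real.log τ| := by
  refine ⟨1, one_pos, 1, one_pos, fun τ hτ hτ1 => ?_⟩
  have hR : τ < τ ^ ((1 : ℝ) / 10) := Real.self_lt_rpow_of_lt_one hτ hτ1 (by norm_num)
  have hR1 : τ ^ ((1 : ℝ) / 10) ≤ 1 := Real.rpow_le_one hτ.le hτ1.le (by norm_num)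
  have hbound := catenoidPrimitive_sub_le hτ hR hR1
  generalize τ ^ ((1 : ℝ) / 10) = R at *
  generalize hf : (fun r : ℝ => Real.cos _ ^ 2 * √_ * Real.sin r) = f
  have hmeas : Measurable f := by
    rw [← hf]
    fun_prop
  have hsin : ∀ r ∈ Set.Ioc τ R, 0 ≤ Real.sin r := fun r hr =>
    Real.sin_nonneg_of_nonneg_of_le_pi (hτ.trans hr.1).le (by linarith [hr.2, Real.pi_gt_three])
  have hf0 : ∀ r ∈ Set.Ioc τ R, 0 ≤ f r := fun r hr => by
    rw [← hf]
    exact mul_nonneg (by positivity) (hsin r hr)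
  have hle : ∀ r ∈ Set.Ioc τ R, f r ≤ Real.sin r + (r ^ 2 / √(r ^ 2 - τ ^ 2) - r) := by
    intro r hr
    have hr0 : 0 < r := hτ.trans hr.1
    have hs : 0 < √(r ^ 2 - τ ^ 2) := Real.sqrt_pos.2 (by nlinarith [hr.1])
    have hone : 1 ≤ r / √(r ^ 2 - τ ^ 2) :=
      (one_le_div hs).2 (Real.sqrt_le_iff.2 ⟨hr0.le, by nlinarith⟩)
    calc f r ≤ r / √(r ^ 2 - τ ^ 2) * Real.sin r := by
          rw [← hf, ← sqrt_one_add_div_sqrt_sq hτ hr.1]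
          exact mul_le_mul_of_nonneg_right
            (mul_sqrt_one_add_div_le (sq_nonneg _) (Real.cos_sq_le_one _) (sq_nonneg _)) (hsin r hr)
      _ = Real.sin r + (r / √(r ^ 2 - τ ^ 2) - 1) * Real.sin r := by ring
      _ ≤ Real.sin r + (r / √(r ^ 2 - τ ^ 2) - 1) * r := by
          have := sub_nonneg.2 hone
          gcongr
          exact Real.sin_le hr0.le
      _ = _ := by ring
  have hderiv : ∀ r ∈ Set.Ioo τ R, HasDerivAt (catenoidPrimitive τ)
      (Real.sin r + (r ^ 2 / √(r ^ 2 - τ ^ 2) - r)) r :=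
    fun r hr => hasDerivAt_catenoidPrimitive hτ hr.1
  have hcont : ContinuousOn (catenoidPrimitive τ) (Set.Icc τ R) :=
    continuousOn_catenoidPrimitive hτ
  have hgint : IntervalIntegrable
      (fun r => Real.sin r + (r ^ 2 / √(r ^ 2 - τ ^ 2) - r)) volume τ R :=
    (intervalIntegrable_iff_integrableOn_Ioc_of_le hR.le).2 <|
      intervalIntegral.integrableOn_deriv_of_nonneg hcont hderiv fun r hr =>
        (hf0 r (Set.Ioo_subset_Ioc_self hr)).trans (hle r (Set.Ioo_subset_Ioc_self hr))
  have hfint : IntervalIntegrable f volume τ R := by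
    refine hgint.mono_fun' hmeas.aestronglyMeasurable ?_
    rw [Set.uIoc_of_le hR.le]
    filter_upwards [ae_restrict_mem measurableSet_Ioc] with r hr
    rw [Real.norm_of_nonneg (hf0 r hr)]
    exact hle r hr
  refine ⟨hfint, ?_⟩
  have hmono := intervalIntegral.integral_mono_on_of_le_Ioo hR.le hfint hgint
    fun r hr => hle r (Set.Ioo_subset_Ioc_self hr)
  rw [intervalIntegral.integral_eq_sub_of_hasDerivAt_of_le hR.le hcont hderiv hgint] at hmono
  have hlogneg : Real.log τ < 0 := Real.log_neg hτ hτ1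
  rw [abs_of_neg hlogneg]
  nlinarith [mul_nonneg (sq_nonneg τ) (neg_nonneg.2 hlogneg.le)]
end

section
/- Let τ > 0 and define F : ℝ² → ℝ⁴ by F(s, ϑ) = E(τ·cosh s, ϑ, τ·s), where E(r, θ, z) = (sin r · cos θ · cos z, sin r · sin θ · cos z, cos r · cos z, sin z). Then for every (s, ϑ): ⟨∂F/∂s, ∂F/∂s⟩ = τ²·cosh² s · (1 − tanh² s · sin²(τ s)), ⟨∂F/∂ϑ, ∂F/∂ϑ⟩ = cos²(τ s) · sin²(τ·cosh s), and ⟨∂F/∂s, ∂F/∂ϑ⟩ = 0. -/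
/-- Pullback metric on the catenoidal bridge (equation (A.3)): with
`F(s, ϑ) = E(τ·cosh s, ϑ, τ·s)` where
`E(r, θ, z) = (sin r cos θ cos z, sin r sin θ cos z, cos r cos z, sin z)`, the partial
derivatives of `F` (expressed via `HasDerivAt` in each variable) satisfy
`⟨F_s, F_s⟩ = τ² cosh² s (1 − tanh² s sin²(τ s))`,
`⟨F_ϑ, F_ϑ⟩ = cos²(τ s) sin²(τ cosh s)` and `⟨F_s, F_ϑ⟩ = 0`, where
`⟨u, v⟩ = ∑ i, u i * v i` is the standard inner product on `ℝ⁴`. -/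
theorem catenoidal_bridge_metric (τ : ℝ) (hτ : 0 < τ) :
    ∀ s ϑ : ℝ, ∃ Fs Fϑ : Fin 4 → ℝ,
      HasDerivAt
        (fun t : ℝ => ![Real.sin (τ * Real.cosh t) * Real.cos ϑ * Real.cos (τ * t),
          Real.sin (τ * Real.cosh t) * Real.sin ϑ * Real.cos (τ * t),
          Real.cos (τ * Real.cosh t) * Real.cos (τ * t), Real.sin (τ * t)])
        Fs s ∧
      HasDerivAt
        (fun t : ℝ => ![Real.sin (τ * Real.cosh s) * Real.cos t * Real.cos (τ * s),
          Real.sin (τ * Real.cosh s) * Real.sin t * Real.cos (τ * s),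
          Real.cos (τ * Real.cosh s) * Real.cos (τ * s), Real.sin (τ * s)])
        Fϑ ϑ ∧
      (∑ i, Fs i * Fs i) =
        τ ^ 2 * Real.cosh s ^ 2 * (1 - Real.tanh s ^ 2 * Real.sin (τ * s) ^ 2) ∧
      (∑ i, Fϑ i * Fϑ i) = Real.cos (τ * s) ^ 2 * Real.sin (τ * Real.cosh s) ^ 2 ∧
      (∑ i, Fs i * Fϑ i) = 0 := by
  intro s ϑ
  set r := τ * Real.cosh s
  set z := τ * s
  have hr : HasDerivAt (fun t : ℝ => τ * Real.cosh t) (τ * Real.sinh s) s :=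
    (Real.hasDerivAt_cosh s).const_mul τ
  have hz : HasDerivAt (fun t : ℝ => τ * t) τ s := by
    simpa using (hasDerivAt_id s).const_mul τ
  have hϑ := Real.sin_sq_add_cos_sq ϑ
  refine ⟨![Real.cos r * (τ * Real.sinh s) * Real.cos ϑ * Real.cos z +
        Real.sin r * Real.cos ϑ * (-Real.sin z * τ),
      Real.cos r * (τ * Real.sinh s) * Real.sin ϑ * Real.cos z +
        Real.sin r * Real.sin ϑ * (-Real.sin z * τ),
      -Real.sin r * (τ * Real.sinh s) * Real.cos z + Real.cos r * (-Real.sin z * τ),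
      Real.cos z * τ],
    ![Real.sin r * -Real.sin ϑ * Real.cos z, Real.sin r * Real.cos ϑ * Real.cos z, 0, 0],
    ?_, ?_, ?_, ?_, ?_⟩
  · rw [hasDerivAt_pi]
    intro i
    fin_cases i
    · exact (hr.sin.mul_const _).mul hz.cos
    · exact (hr.sin.mul_const _).mul hz.cos
    · exact hr.cos.mul hz.cos
    · exact hz.sin
  · rw [hasDerivAt_pi]
    intro i
    fin_cases i
    · exact ((Real.hasDerivAt_cos ϑ).const_mul _).mul_const _
    · exact ((Real.hasDerivAt_sin ϑ).const_mul _).mul_const _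
    · exact hasDerivAt_const _ _
    · exact hasDerivAt_const _ _
  · have hsinh : Real.cosh s * Real.tanh s = Real.sinh s := by
      rw [Real.tanh_eq_sinh_div_cosh, mul_div_cancel₀ _ (Real.cosh_pos s).ne']
    simp only [Fin.sum_univ_four, Matrix.cons_val]
    linear_combination
      (Real.cos r * τ * Real.sinh s * Real.cos z - Real.sin r * Real.sin z * τ) ^ 2 * hϑ +
      τ ^ 2 * (Real.sinh s ^ 2 * Real.cos z ^ 2 + Real.sin z ^ 2) * Real.sin_sq_add_cos_sq r +
      τ ^ 2 * (Real.sinh s ^ 2 + 1) * Real.sin_sq_add_cos_sq z -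
      τ ^ 2 * Real.cosh_sq_sub_sinh_sq s +
      τ ^ 2 * Real.sin z ^ 2 * (Real.cosh s * Real.tanh s + Real.sinh s) * hsinh
  · simp only [Fin.sum_univ_four, Matrix.cons_val]
    linear_combination Real.sin r ^ 2 * Real.cos z ^ 2 * hϑ
  · simp only [Fin.sum_univ_four, Matrix.cons_val]
    ring
end

section
/- Let τ > 0, let E(r, θ, z) = (sin r · cos θ · cos z, sin r · sin θ · cos z, cos r · cos z, sin z), and let F(s, ϑ) = E(τ·cosh s, ϑ, τ·s). For (s, ϑ) with |τ s| < π/2, define N(s, ϑ) ∈ ℝ⁴ by N = ( tanh s · ∂E/∂z − sec²(τ s) · sech s · ∂E/∂r ) / √(1 + tan²(τ s) · sech² s), where the partial derivatives of E are evaluated at (τ·cosh s, ϑ, τ·s). Then ⟨N, N⟩ = 1, ⟨N, F⟩ = 0, ⟨N, ∂F/∂s⟩ = 0, and ⟨N, ∂F/∂ϑ⟩ = 0. -/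
theorem hasDerivAt_vec_four {f g h k : ℝ → ℝ} {f' g' h' k' x : ℝ} (hf : HasDerivAt f f' x)
    (hg : HasDerivAt g g' x) (hh : HasDerivAt h h' x) (hk : HasDerivAt k k' x) :
    HasDerivAt (fun t => ![f t, g t, h t, k t]) ![f', g', h', k'] x := by
  rw [hasDerivAt_pi]
  intro i
  fin_cases i <;> assumption

theorem vec4_dotProduct (a b c d a' b' c' d' : ℝ) :
    ![a, b, c, d] ⬝ᵥ ![a', b', c', d'] = a * a' + b * b' + c * c' + d * d' := by
  simp [dotProduct, Fin.sum_univ_four]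

/-- The unit normal of the catenoidal bridge in `S³` (Appendix A): with
`E(r, θ, z) = (sin r cos θ cos z, sin r sin θ cos z, cos r cos z, sin z)`,
`F(s, ϑ) = E(τ cosh s, ϑ, τ s)`, partial derivatives `Er = ∂E/∂r`, `Ez = ∂E/∂z` at the
point `(τ cosh s, ϑ, τ s)` and `Fs = ∂F/∂s`, `Fϑ = ∂F/∂ϑ` (expressed via `HasDerivAt`),
and provided `|τ s| < π/2`, the vector
`N = (tanh s · Ez − sec²(τ s) · sech s · Er) / √(1 + tan²(τ s) · sech² s)`
satisfies `⟨N, N⟩ = 1`, `⟨N, F⟩ = 0`, `⟨N, Fs⟩ = 0` and `⟨N, Fϑ⟩ = 0`, where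
`⟨u, v⟩ = ∑ i, u i * v i` is the standard inner product on `ℝ⁴`. -/
theorem catenoidal_bridge_unit_normal (τ : ℝ) (hτ : 0 < τ) (s ϑ : ℝ)
    (hs : |τ * s| < Real.pi / 2)
    (Er Ez Fs Fϑ : Fin 4 → ℝ)
    (hEr : HasDerivAt
      (fun t : ℝ => ![Real.sin t * Real.cos ϑ * Real.cos (τ * s),
        Real.sin t * Real.sin ϑ * Real.cos (τ * s),
        Real.cos t * Real.cos (τ * s), Real.sin (τ * s)])
      Er (τ * Real.cosh s))
    (hEz : HasDerivAt
      (fun t : ℝ => ![Real.sin (τ * Real.cosh s) * Real.cos ϑ * Real.cos t,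
        Real.sin (τ * Real.cosh s) * Real.sin ϑ * Real.cos t,
        Real.cos (τ * Real.cosh s) * Real.cos t, Real.sin t])
      Ez (τ * s))
    (hFs : HasDerivAt
      (fun t : ℝ => ![Real.sin (τ * Real.cosh t) * Real.cos ϑ * Real.cos (τ * t),
        Real.sin (τ * Real.cosh t) * Real.sin ϑ * Real.cos (τ * t),
        Real.cos (τ * Real.cosh t) * Real.cos (τ * t), Real.sin (τ * t)])
      Fs s)
    (hFϑ : HasDerivAt
      (fun t : ℝ => ![Real.sin (τ * Real.cosh s) * Real.cos t * Real.cos (τ * s),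
        Real.sin (τ * Real.cosh s) * Real.sin t * Real.cos (τ * s),
        Real.cos (τ * Real.cosh s) * Real.cos (τ * s), Real.sin (τ * s)])
      Fϑ ϑ)
    (N : Fin 4 → ℝ)
    (hN : N = (Real.sqrt (1 + Real.tan (τ * s) ^ 2 * ((Real.cosh s)⁻¹) ^ 2))⁻¹ •
      (Real.tanh s • Ez - (((Real.cos (τ * s))⁻¹) ^ 2 * (Real.cosh s)⁻¹) • Er)) :
    (∑ i, N i * N i) = 1 ∧
    (∑ i, N i * (![Real.sin (τ * Real.cosh s) * Real.cos ϑ * Real.cos (τ * s),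
        Real.sin (τ * Real.cosh s) * Real.sin ϑ * Real.cos (τ * s),
        Real.cos (τ * Real.cosh s) * Real.cos (τ * s), Real.sin (τ * s)] : Fin 4 → ℝ) i) = 0 ∧
    (∑ i, N i * Fs i) = 0 ∧
    (∑ i, N i * Fϑ i) = 0 := by
  have hq : Real.cos (τ * s) ≠ 0 := (Real.cos_pos_of_mem_Ioo (abs_lt.mp hs)).ne'
  have hC : Real.cosh s ≠ 0 := (Real.cosh_pos s).ne'
  have er : Er = ![Real.cos (τ * Real.cosh s) * Real.cos ϑ * Real.cos (τ * s),
      Real.cos (τ * Real.cosh s) * Real.sin ϑ * Real.cos (τ * s),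
      -Real.sin (τ * Real.cosh s) * Real.cos (τ * s), 0] :=
    hEr.unique <| hasDerivAt_vec_four
      (((Real.hasDerivAt_sin _).mul_const _).mul_const _)
      (((Real.hasDerivAt_sin _).mul_const _).mul_const _)
      ((Real.hasDerivAt_cos _).mul_const _) (hasDerivAt_const _ _)
  have ez : Ez = ![Real.sin (τ * Real.cosh s) * Real.cos ϑ * -Real.sin (τ * s),
      Real.sin (τ * Real.cosh s) * Real.sin ϑ * -Real.sin (τ * s),
      Real.cos (τ * Real.cosh s) * -Real.sin (τ * s), Real.cos (τ * s)] :=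
    hEz.unique <| hasDerivAt_vec_four
      ((Real.hasDerivAt_cos _).const_mul _) ((Real.hasDerivAt_cos _).const_mul _)
      ((Real.hasDerivAt_cos _).const_mul _) (Real.hasDerivAt_sin _)
  have eϑ : Fϑ = ![Real.sin (τ * Real.cosh s) * -Real.sin ϑ * Real.cos (τ * s),
      Real.sin (τ * Real.cosh s) * Real.cos ϑ * Real.cos (τ * s), 0, 0] :=
    hFϑ.unique <| hasDerivAt_vec_four
      (((Real.hasDerivAt_cos _).const_mul _).mul_const _)
      (((Real.hasDerivAt_sin _).const_mul _).mul_const _)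
      (hasDerivAt_const _ _) (hasDerivAt_const _ _)
  have hr : HasDerivAt (fun t => τ * Real.cosh t) (τ * Real.sinh s) s :=
    (Real.hasDerivAt_cosh s).const_mul τ
  have hz : HasDerivAt (fun t => τ * t) τ s := hasDerivAt_const_mul τ
  have es : Fs = (τ * Real.sinh s) • Er + τ • Ez := by
    refine (hFs.unique <| hasDerivAt_vec_four
      ((hr.sin.mul_const _).mul hz.cos) ((hr.sin.mul_const _).mul hz.cos)
      (hr.cos.mul hz.cos) hz.sin).trans ?_
    rw [er, ez]
    ext i
    fin_cases i <;> simp <;> ring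
  have hθ := Real.sin_sq_add_cos_sq ϑ
  have hρ := Real.sin_sq_add_cos_sq (τ * Real.cosh s)
  have hζ := Real.sin_sq_add_cos_sq (τ * s)
  have hrr : Er ⬝ᵥ Er = Real.cos (τ * s) ^ 2 := by
    simp only [er, vec4_dotProduct]
    grind
  have hzz : Ez ⬝ᵥ Ez = 1 := by
    simp only [ez, vec4_dotProduct]
    grind
  have hrz : Er ⬝ᵥ Ez = 0 := by
    simp only [er, ez, vec4_dotProduct]
    grind
  have hzr : Ez ⬝ᵥ Er = 0 := by rw [dotProduct_comm, hrz]
  have hrϑ : Er ⬝ᵥ Fϑ = 0 := by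
    simp only [er, eϑ, vec4_dotProduct]
    ring
  have hzϑ : Ez ⬝ᵥ Fϑ = 0 := by
    simp only [ez, eϑ, vec4_dotProduct]
    ring
  change N ⬝ᵥ N = 1 ∧ N ⬝ᵥ _ = 0 ∧ N ⬝ᵥ Fs = 0 ∧ N ⬝ᵥ Fϑ = 0
  refine ⟨?_, ?_, ?_, ?_⟩
  · have hpos : 0 < 1 + Real.tan (τ * s) ^ 2 * (Real.cosh s)⁻¹ ^ 2 := by positivity
    have hnum : Real.tanh s ^ 2
        + ((Real.cos (τ * s))⁻¹ ^ 2 * (Real.cosh s)⁻¹) ^ 2 * Real.cos (τ * s) ^ 2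
        = 1 + Real.tan (τ * s) ^ 2 * (Real.cosh s)⁻¹ ^ 2 := by
      rw [Real.tanh_eq_sinh_div_cosh, Real.tan_eq_sin_div_cos]
      field_simp
      rw [Real.sinh_sq, Real.sin_sq]
      ring
    have hsqrt := Real.sq_sqrt hpos.le
    have hsqrt_ne := (Real.sqrt_pos.mpr hpos).ne'
    simp only [hN, smul_dotProduct, dotProduct_smul, sub_dotProduct, dotProduct_sub, hrr, hzz, hrz,
      hzr, smul_eq_mul]
    generalize Real.sqrt _ = R at *
    rw [← hnum] at hsqrt
    field_simp at hsqrt ⊢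
    linarith
  · have hrF : Er ⬝ᵥ ![Real.sin (τ * Real.cosh s) * Real.cos ϑ * Real.cos (τ * s),
        Real.sin (τ * Real.cosh s) * Real.sin ϑ * Real.cos (τ * s),
        Real.cos (τ * Real.cosh s) * Real.cos (τ * s), Real.sin (τ * s)] = 0 := by
      simp only [er, vec4_dotProduct]
      grind
    have hzF : Ez ⬝ᵥ ![Real.sin (τ * Real.cosh s) * Real.cos ϑ * Real.cos (τ * s),
        Real.sin (τ * Real.cosh s) * Real.sin ϑ * Real.cos (τ * s),
        Real.cos (τ * Real.cosh s) * Real.cos (τ * s), Real.sin (τ * s)] = 0 := by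
      simp only [ez, vec4_dotProduct]
      grind
    simp only [hN, smul_dotProduct, sub_dotProduct, hrF, hzF, smul_zero, sub_zero]
  · simp only [hN, es, smul_dotProduct, dotProduct_smul, sub_dotProduct, dotProduct_add, hrr, hzz,
      hrz, hzr, smul_eq_mul, Real.tanh_eq_sinh_div_cosh]
    field_simp
    ring
  · simp only [hN, smul_dotProduct, sub_dotProduct, hrϑ, hzϑ, smul_zero, sub_zero]
end
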